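/- arXiv:2211.07599 — 5 statements merged into one kernel-verified Lean document; each statement's English description precedes it below -/
import Mathlib

section
/- Let s < 4 with s ≠ 0 and s ≠ 2, and for each integer N ≥ 2 set I_s(N) = (N²/2^s)·∫₀^∞ x^{-s/2}(1+x)^{s/2} Φ_N(x) dx (the expected Riesz s-energy of the zeros of a random elliptic polynomial mapped to the sphere). Then lim_{N→∞} ( I_s(N) − (2^{1−s}/(2−s))·N² ) / N^{1+s/2} = C(s), where C(s) = 2^{-s}·(s/2)·(1 + s/2)·Γ(1 − s/2)·ζ(1 − s/2) and ζ is the analytically continued Riemann zeta function. -/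
open MeasureTheory Set Filter

/-- The 2-point intensity factor for zeros of degree-`N` random elliptic polynomials. -/
noncomputable def Phi (N : ℕ) (x : ℝ) : ℝ :=
  (((1+x)^N - 1 - N*x)^2 * (1+x)^(N-2) +
    ((1+x)^N - 1 - N*x*(1+x)^(N-1))^2) / ((1+x)^N - 1)^3

/-- The expected Riesz `s`-energy of the `N` zeros of a random elliptic polynomial
mapped to the sphere. -/
noncomputable def Ienergy (s : ℝ) (N : ℕ) : ℝ :=
  (N:ℝ)^2 / 2 ^ s * ∫ x in Ioi (0:ℝ), x ^ (-s/2) * (1+x) ^ (s/2) * Phi N x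

/-- The second-order constant `C(s) = 2^{-s}(s/2)(1+s/2)Γ(1−s/2)ζ(1−s/2)`. -/
noncomputable def Cconst (s : ℝ) : ℝ :=
  2 ^ (-s) * (s/2) * (1 + s/2) * Real.Gamma (1 - s/2) * (riemannZeta ((1 - s/2 : ℝ) : ℂ)).re


noncomputable def PhiInf (y : ℝ) : ℝ :=
  ((Real.exp y - 1 - y)^2 * Real.exp y + (Real.exp y - 1 - y * Real.exp y)^2) / (Real.exp y - 1)^3

lemma bernoulli_aux (N : ℕ) {x : ℝ} (hx : 0 ≤ x) : 1 + N * x ≤ (1+x)^N :=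
  one_add_mul_le_pow (by linarith) N

lemma pow_le_exp_aux (N : ℕ) {x : ℝ} (hx : 0 ≤ x) : (1+x)^N ≤ Real.exp (N*x) := by
  rw [Real.exp_nat_mul]
  apply pow_le_pow_left₀ (by linarith)
  linarith [Real.add_one_le_exp x]

lemma Phi_small {N : ℕ} {x : ℝ} (hx : 0 < x) (hN : 1 ≤ N) (hy : N * x ≤ 1) :
    |Phi N x| ≤ 7 * (N * x) := by
  have hNx : 0 < N * x := by positivity
  set y := N * x with hydef
  have h1 := bernoulli_aux N hx.le
  have h2 := pow_le_exp_aux N hx.le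
  have h3 : Real.exp y ≤ 1 + y + y^2 := by
    have := Real.abs_exp_sub_one_sub_id_le (x := y) (by rw [abs_of_pos hNx]; exact hy)
    have := (abs_le.1 this).2
    linarith
  have hp1 : (1+x)^(N-1) ≤ (1+x)^N := pow_le_pow_right₀ (by linarith) (by omega)
  have hq1 : (1+x)^(N-2) ≤ (1+x)^N := pow_le_pow_right₀ (by linarith) (by omega)
  have hp0 : 1 ≤ (1+x)^(N-1) := one_le_pow₀ (by linarith)
  have hq0 : 1 ≤ (1+x)^(N-2) := one_le_pow₀ (by linarith)
  unfold Phi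
  rw [← hydef] at *
  generalize (1+x)^N = a at *
  generalize (1+x)^(N-1) = p at *
  generalize (1+x)^(N-2) = q at *
  have ha3 : a ≤ 3 := by nlinarith
  have hA : (a - 1 - y)^2 ≤ (y^2)^2 := by
    apply pow_le_pow_left₀ <;> linarith
  have hB : (a - 1 - y * p)^2 ≤ (2*y^2)^2 := by
    apply sq_le_sq'
    · nlinarith
    · nlinarith
  have hD : y^3 ≤ (a-1)^3 := pow_le_pow_left₀ hNx.le (by linarith) 3
  have hD0 : 0 < y^3 := by positivity
  have hnum : (a - 1 - y)^2 * q + (a - 1 - y * p)^2 ≤ 7 * y^4 := by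
    have : (a - 1 - y)^2 * q ≤ (y^2)^2 * 3 := by
      apply mul_le_mul hA (by linarith) (by linarith) (by positivity)
    nlinarith
  have hq00 : 0 < q := by linarith
  rw [abs_of_nonneg (div_nonneg (by positivity) (by linarith)), div_le_iff₀ (by linarith)]
  calc _ ≤ 7 * y^4 := hnum
    _ = 7 * y * y^3 := by ring
    _ ≤ _ := by gcongr

lemma Phi_large {N : ℕ} {x : ℝ} (hx : 0 < x) (hN : 2 ≤ N) (hy : 1 ≤ N * x) :
    |Phi N x - ((1+x)^2)⁻¹| ≤ 22 * (N * x)^2 / (1+x)^N := by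
  have hNx : 0 < N * x := by positivity
  set y := N * x with hydef
  have h1 := bernoulli_aux N hx.le
  have hp1 : (1+x)^(N-1) ≤ (1+x)^N := pow_le_pow_right₀ (by linarith) (by omega)
  have hp0 : 1 ≤ (1+x)^(N-1) := one_le_pow₀ (by linarith)
  have hq : (1+x)^N = (1+x)^(N-2) * (1+x)^2 := by rw [← pow_add]; congr 1; omega
  have hd1 : 1 ≤ (1+x)^2 := one_le_pow₀ (by linarith)
  unfold Phi
  rw [← hydef] at *
  generalize (1+x)^N = a at *
  generalize (1+x)^(N-1) = p at *
  generalize (1+x)^(N-2) = q at *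
  generalize (1+x)^2 = d at *
  obtain ⟨b, rfl⟩ : ∃ b, a = b + 1 := ⟨a - 1, by ring⟩
  have hb : y ≤ b := by linarith
  have hb0 : 0 < b := by linarith
  have hd0 : 0 < d := by linarith
  have hqe : q = (b+1)/d := by rw [hq]; field_simp
  have e : ((b + 1 - 1 - y) ^ 2 * q + (b + 1 - 1 - y * p) ^ 2) / (b + 1 - 1) ^ 3 - d⁻¹
      = d⁻¹ * ((b^2 - 2*b^2*y - 2*b*y + b*y^2 + y^2)/b^3) + (b - y*p)^2/b^3 := by
    rw [hqe, add_sub_cancel_right]; field_simp; ring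
  rw [e]
  have t1 : |(b^2 - 2*b^2*y - 2*b*y + b*y^2 + y^2)/b^3| ≤ 7*y^2/b := by
    rw [abs_div, abs_of_pos (by positivity : 0 < b^3), div_le_div_iff₀ (by positivity) hb0]
    have hb1 : 1 ≤ b := by linarith
    have k1 : b^2 ≤ b^2*y^2 := by nlinarith [mul_pos hb0 hb0, mul_nonneg (sub_nonneg.2 hy) hNx.le]
    have k2 : b^2*y ≤ b^2*y^2 := by nlinarith [mul_pos hb0 hb0, mul_nonneg (sub_nonneg.2 hy) hNx.le]
    have k3 : b*y^2 ≤ b^2*y^2 := by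
      have : b ≤ b^2 := by nlinarith
      gcongr
    have k4 : b*y ≤ b^2*y^2 := by
      have : 1 ≤ b*y := by nlinarith
      nlinarith
    have k5 : y^2 ≤ b^2*y^2 := by
      have : 1 ≤ b^2 := by nlinarith
      nlinarith [sq_nonneg y]
    have : |b^2 - 2*b^2*y - 2*b*y + b*y^2 + y^2| ≤ 7*(b^2*y^2) := by
      have g1 : 0 ≤ b^2 := by positivity
      have g2 : 0 ≤ b^2*y := by positivity
      have g3 : 0 ≤ b*y := by positivity
      have g4 : 0 ≤ b*y^2 := by positivity
      have g5 : 0 ≤ y^2 := by positivity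
      rw [abs_le]; constructor <;> linarith
    calc _ ≤ 7*(b^2*y^2) * b := by gcongr
      _ = _ := by ring
  have t2 : |(b - y*p)^2/b^3| ≤ 4*y^2/b := by
    rw [abs_of_nonneg (by positivity), div_le_div_iff₀ (by positivity) hb0]
    have : (b - y*p)^2 ≤ (2*y*b)^2 := by
      apply sq_le_sq' <;> nlinarith
    calc _ ≤ (2*y*b)^2 * b := by gcongr
      _ = _ := by ring
  have t3 : |d⁻¹ * ((b^2 - 2*b^2*y - 2*b*y + b*y^2 + y^2)/b^3)| ≤ 7*y^2/b := by
    rw [abs_mul, abs_of_pos (by positivity : 0 < d⁻¹)]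
    have := inv_le_one_of_one_le₀ hd1
    calc _ ≤ 1 * |(b^2 - 2*b^2*y - 2*b*y + b*y^2 + y^2)/b^3| := by gcongr
      _ ≤ _ := by rw [one_mul]; exact t1
  calc _ ≤ 7*y^2/b + 4*y^2/b := (abs_add_le _ _).trans (add_le_add t3 t2)
    _ ≤ _ := by
      rw [← add_div, div_le_div_iff₀ hb0 (by linarith)]
      nlinarith [sq_nonneg y]

lemma pow_lower {M N : ℕ} (hM : 1 ≤ M) (hMN : M ≤ N) {y : ℝ} (hy : 0 < y) :
    (y/M)^M ≤ (1 + y/N)^N := by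
  have hM0 : (0:ℝ) < M := by exact_mod_cast hM
  have hN0 : (0:ℝ) < N := by exact_mod_cast (by omega : 0 < N)
  have h := one_add_mul_self_le_rpow_one_add (s := y/N) (p := (N:ℝ)/M) (by have := div_pos hy hN0; linarith)
    (by rw [one_le_div hM0]; exact_mod_cast hMN)
  have h2 : (N:ℝ)/M * (y/N) = y/M := by field_simp
  rw [h2] at h
  have hpos : 0 < y/N := by positivity
  have h3 : ((1 + y/N) ^ ((N:ℝ)/M))^M = (1+y/N)^N := by
    rw [← Real.rpow_natCast, ← Real.rpow_mul (by linarith), div_mul_cancel₀ _ hM0.ne', Real.rpow_natCast]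
  rw [← h3]
  apply pow_le_pow_left₀ (by positivity)
  linarith

lemma Phi_tendsto {y : ℝ} (hy : 0 < y) :
    Tendsto (fun N : ℕ => Phi N (y/N)) atTop (nhds (PhiInf y)) := by
  have h0 := Real.tendsto_one_add_div_pow_exp y
  have hz : Tendsto (fun N : ℕ => 1 + y/(N:ℝ)) atTop (nhds 1) := by
    simpa using (tendsto_const_div_atTop_nhds_zero_nat y).const_add 1
  have h1 : Tendsto (fun N : ℕ => (1 + y/(N:ℝ))^(N-1)) atTop (nhds (Real.exp y)) := by
    have := h0.div hz one_ne_zero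
    rw [div_one] at this
    refine this.congr' ?_
    filter_upwards [eventually_ge_atTop 1] with N hN
    have : 0 < 1 + y/(N:ℝ) := by positivity
    simp only [Pi.div_apply]
    rw [div_eq_iff this.ne', ← pow_succ]; congr 1; omega
  have h2 : Tendsto (fun N : ℕ => (1 + y/(N:ℝ))^(N-2)) atTop (nhds (Real.exp y)) := by
    have := h1.div hz one_ne_zero
    rw [div_one] at this
    refine this.congr' ?_
    filter_upwards [eventually_ge_atTop 2] with N hN
    have : 0 < 1 + y/(N:ℝ) := by positivity
    simp only [Pi.div_apply]
    rw [div_eq_iff this.ne', ← pow_succ]; congr 1; omega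
  have hne : (Real.exp y - 1)^3 ≠ 0 := by
    have := Real.add_one_lt_exp hy.ne'
    apply pow_ne_zero; linarith
  have key : Tendsto (fun N : ℕ => (((1 + y/(N:ℝ))^N - 1 - y)^2 * (1 + y/(N:ℝ))^(N-2) +
    ((1 + y/(N:ℝ))^N - 1 - y*(1 + y/(N:ℝ))^(N-1))^2) / ((1 + y/(N:ℝ))^N - 1)^3) atTop (nhds (PhiInf y)) := by
    unfold PhiInf
    exact (((((h0.sub_const 1).sub_const y).pow 2).mul h2).add
      (((h0.sub_const 1).sub (h1.const_mul y)).pow 2)).div ((h0.sub_const 1).pow 3) hne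
  refine key.congr' ?_
  filter_upwards [eventually_ge_atTop 1] with N hN
  have hN0 : (N:ℝ) ≠ 0 := by exact_mod_cast (by omega : N ≠ 0)
  unfold Phi
  rw [mul_div_cancel₀ _ hN0]

lemma PhiInf_small {y : ℝ} (hy : 0 < y) (hy1 : y ≤ 1) : |PhiInf y| ≤ 7 * y := by
  refine le_of_tendsto (Phi_tendsto hy).abs ?_
  filter_upwards [eventually_ge_atTop 1] with N hN
  have hN0 : (0:ℝ) < N := by exact_mod_cast hN
  have e : (N:ℝ) * (y/N) = y := mul_div_cancel₀ _ hN0.ne'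
  have := Phi_small (N := N) (x := y/N) (by positivity) hN (by rw [e]; exact hy1)
  rwa [e] at this

lemma Phi_large' {M N : ℕ} (hM : 1 ≤ M) (hN : 2 ≤ N) (hMN : M ≤ N) {y : ℝ} (hy : 1 ≤ y) :
    |Phi N (y/N) - ((1+y/N)^2)⁻¹| ≤ 22 * M^M * y^2 / y^M := by
  have hM0 : (0:ℝ) < M := by exact_mod_cast hM
  have hN0 : (0:ℝ) < N := by exact_mod_cast (by omega : 0 < N)
  have hy0 : 0 < y := by linarith
  have e : (N:ℝ) * (y/N) = y := mul_div_cancel₀ _ hN0.ne'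
  have := Phi_large (N := N) (x := y/N) (by positivity) hN (by rw [e]; exact hy)
  rw [e] at this
  refine this.trans ?_
  calc _ ≤ 22 * y^2 / (y/M)^M := by
        apply div_le_div_of_nonneg_left (by positivity) (by positivity) (pow_lower hM hMN hy0)
    _ = _ := by rw [div_pow]; field_simp

lemma PhiInf_large {M : ℕ} (hM : 1 ≤ M) {y : ℝ} (hy : 1 ≤ y) :
    |PhiInf y - 1| ≤ 22 * M^M * y^2 / y^M := by
  have hz : Tendsto (fun N : ℕ => ((1 + y/(N:ℝ))^2)⁻¹) atTop (nhds 1) := by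
    have := (((tendsto_const_div_atTop_nhds_zero_nat y).const_add 1).pow 2).inv₀ (by norm_num)
    simpa using this
  refine le_of_tendsto ((Phi_tendsto (by linarith : 0 < y)).sub hz).abs ?_
  filter_upwards [eventually_ge_atTop 2, eventually_ge_atTop M] with N hN hMN
  exact Phi_large' hM hN hMN hy

noncomputable def gker (u : ℝ) : ℂ := (2 - 4 * (u:ℂ) + (u:ℂ)^2) * Real.exp (-u)

lemma hasMellin_gker {w : ℂ} (hw : 0 < w.re) :
    HasMellin gker w ((1-w)*(2-w)*Complex.Gamma w) := by
  have hE : ∀ v : ℂ, 0 < v.re → HasMellin (fun t : ℝ => ((Real.exp (-t) : ℝ) : ℂ)) v (Complex.Gamma v) := by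
    intro v hv
    constructor
    · have := Complex.GammaIntegral_convergent hv
      unfold MellinConvergent
      refine this.congr_fun (fun t _ => ?_) measurableSet_Ioi
      simp [mul_comm]
    · rw [Complex.Gamma_eq_integral hv, Complex.GammaIntegral_eq_mellin]
  have h0 := hE w hw
  have h1 := hE (w+1) (by simp; linarith)
  have h2 := hE (w+2) (by simp; linarith)
  have c1 : HasMellin (fun t : ℝ => (t:ℂ)^(1:ℂ) • ((Real.exp (-t) : ℝ) : ℂ)) w (Complex.Gamma (w+1)) :=
    ⟨MellinConvergent.cpow_smul.2 h1.1, by rw [mellin_cpow_smul, h1.2]⟩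
  have c2 : HasMellin (fun t : ℝ => (t:ℂ)^(2:ℂ) • ((Real.exp (-t) : ℝ) : ℂ)) w (Complex.Gamma (w+2)) :=
    ⟨MellinConvergent.cpow_smul.2 h2.1, by rw [mellin_cpow_smul, h2.2]⟩
  have a0 := hasMellin_const_smul h0.1 (2:ℂ)
  have a1 := hasMellin_const_smul c1.1 (4:ℂ)
  have b := hasMellin_add (hasMellin_sub a0.1 a1.1).1 c2.1
  have hw0 : w ≠ 0 := by rintro rfl; simp at hw
  have hw1 : w + 1 ≠ 0 := by
    intro h; have := congrArg Complex.re h; simp at this; linarith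
  rw [(hasMellin_sub a0.1 a1.1).2, a0.2, a1.2, c2.2, c1.2, h0.2] at b
  convert b using 1
  · funext t
    simp only [gker, smul_eq_mul, Complex.cpow_one, Complex.cpow_ofNat]
    ring
  · have : w + 2 = (w+1)+1 := by ring
    rw [this, Complex.Gamma_add_one _ hw1, Complex.Gamma_add_one _ hw0]
    simp only [smul_eq_mul]; ring

lemma hasSum_gker {t : ℝ} (ht : 0 < t) :
    HasSum (fun n : ℕ => gker (((n:ℝ)+1) * t)) (((PhiInf t - 1 : ℝ)) : ℂ) := by
  set r := Real.exp (-t) with hr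
  have hr0 : 0 < r := Real.exp_pos _
  have hr1 : r < 1 := by rw [hr, ← Real.exp_zero, Real.exp_lt_exp]; linarith
  have hn : ‖r‖ < 1 := by rw [Real.norm_eq_abs, abs_of_pos hr0]; exact hr1
  have s0 := hasSum_choose_mul_geometric_of_norm_lt_one 0 hn
  have s1 := hasSum_choose_mul_geometric_of_norm_lt_one 1 hn
  have s2 := hasSum_choose_mul_geometric_of_norm_lt_one 2 hn
  have S := ((s0.mul_left (2*r)).add ((s1.mul_left (-4*t*r - t^2*r)))).add (s2.mul_left (2*t^2*r))
  have : HasSum (fun n : ℕ => (2 - 4 * (((n:ℝ)+1)*t) + (((n:ℝ)+1)*t)^2) * Real.exp (-(((n:ℝ)+1)*t))) (PhiInf t - 1) := by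
    convert! S using 1
    · funext n
      have e : Real.exp (-(((n:ℝ)+1)*t)) = r * r^n := by
        rw [hr, ← Real.exp_nat_mul, ← Real.exp_add]; congr 1; ring
      rw [e]
      have c2 : (((n+2).choose 2 : ℕ) : ℝ) = (n+2)*(n+1)/2 := by
        rw [Nat.cast_choose_two]; push_cast; ring
      rw [c2]
      simp only [Nat.choose_zero_right, Nat.choose_one_right]
      push_cast; ring
    · have he : Real.exp t = r⁻¹ := by rw [hr, Real.exp_neg, inv_inv]
      unfold PhiInf
      rw [he]
      have h1 : 1 - r ≠ 0 := by linarith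
      have h2 : r⁻¹ - 1 = (1-r)/r := by field_simp
      rw [h2]
      field_simp
      ring
  have h := Complex.hasSum_ofReal.2 this
  convert h using 1
  funext n
  simp only [gker]; push_cast; ring_nf

lemma mellin_PhiInf {w : ℂ} (hw : 1 < w.re) :
    mellin (fun t => ((PhiInf t - 1 : ℝ) : ℂ)) w = (1-w)*(2-w)*Complex.Gamma w * riemannZeta w := by
  have hg := hasMellin_gker (w := w) (by linarith)
  have hpos : ∀ n : ℕ, (0:ℝ) < (n:ℝ)+1 := fun n => by positivity
  set K : ℝ := ∫ t in Ioi (0:ℝ), ‖(t:ℂ)^(w-1) • gker t‖ with hK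
  have hnorm : ∀ n : ℕ, ∫ t in Ioi (0:ℝ), ‖(t:ℂ)^(w-1) • gker (((n:ℝ)+1)*t)‖ = K / ((n:ℝ)+1)^w.re := by
    intro n
    have := integral_comp_mul_left_Ioi (fun t : ℝ => ‖(t:ℂ)^(w-1) • gker t‖) 0 (hpos n)
    rw [mul_zero, ← hK] at this
    have e : ∀ t ∈ Ioi (0:ℝ), ‖(t:ℂ)^(w-1) • gker (((n:ℝ)+1)*t)‖ =
        ((n:ℝ)+1)^(1 - w.re) * ‖((((n:ℝ)+1)*t : ℝ):ℂ)^(w-1) • gker (((n:ℝ)+1)*t)‖ := by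
      intro t ht
      have ht : 0 < t := ht
      rw [norm_smul, norm_smul, Complex.norm_cpow_eq_rpow_re_of_pos ht,
        Complex.norm_cpow_eq_rpow_re_of_pos (mul_pos (hpos n) ht), Real.mul_rpow (hpos n).le ht.le]
      simp only [Complex.sub_re, Complex.one_re]
      rw [← mul_assoc, ← mul_assoc, ← Real.rpow_add (hpos n)]
      simp
    rw [setIntegral_congr_fun measurableSet_Ioi e, integral_const_mul, this, smul_eq_mul,
      Real.rpow_sub (hpos n), Real.rpow_one]
    have := (hpos n).ne'
    have := (Real.rpow_pos_of_pos (hpos n) w.re).ne'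
    field_simp
  have hS := hasSum_integral_of_summable_integral_norm (μ := volume.restrict (Ioi (0:ℝ)))
    (F := fun (n:ℕ) (t:ℝ) => (t:ℂ)^(w-1) • gker (((n:ℝ)+1)*t))
    (fun n => (MellinConvergent.comp_mul_left (f := gker) (s := w) (hpos n)).2 hg.1) ?_
  · have e1 : ∫ t in Ioi (0:ℝ), ∑' n : ℕ, (t:ℂ)^(w-1) • gker (((n:ℝ)+1)*t) =
        mellin (fun t => ((PhiInf t - 1 : ℝ) : ℂ)) w := by
      refine setIntegral_congr_fun measurableSet_Ioi fun t ht => ?_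
      exact ((hasSum_gker (t := t) ht).const_smul ((t:ℂ)^(w-1))).tsum_eq
    rw [e1] at hS
    have e2 : ∀ n : ℕ, ∫ t in Ioi (0:ℝ), (t:ℂ)^(w-1) • gker (((n:ℝ)+1)*t) =
        (1-w)*(2-w)*Complex.Gamma w * (1 / ((n:ℂ)+1)^w) := by
      intro n
      have := mellin_comp_mul_left gker w (hpos n)
      rw [hg.2] at this
      rw [mellin] at this
      rw [this, smul_eq_mul, Complex.cpow_neg]
      push_cast
      rw [one_div]; ring
    simp only [e2] at hS
    rw [← hS.tsum_eq, tsum_mul_left, zeta_eq_tsum_one_div_nat_add_one_cpow hw]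
  · simp only [hnorm]
    have := (summable_nat_add_iff 1).2 (Real.summable_one_div_nat_rpow.2 hw)
    have := this.mul_left K
    refine this.congr fun n => ?_
    push_cast
    rw [mul_one_div]

noncomputable def fker (t : ℝ) : ℝ := PhiInf t - (Ioi (1:ℝ)).indicator (fun _ => (1:ℝ)) t

lemma continuousOn_PhiInf : ContinuousOn PhiInf (Ioi 0) := by
  unfold PhiInf
  apply ContinuousOn.div (by fun_prop) (by fun_prop)
  intro t ht
  have ht : 0 < t := ht
  have := Real.add_one_lt_exp ht.ne'
  apply pow_ne_zero; linarith

lemma locInt_fker : LocallyIntegrableOn (fun t => (fker t : ℂ)) (Ioi 0) := by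
  have h1 : LocallyIntegrableOn (fun t => (PhiInf t : ℂ)) (Ioi 0) :=
    (Complex.continuous_ofReal.comp_continuousOn continuousOn_PhiInf).locallyIntegrableOn measurableSet_Ioi
  have h2 : LocallyIntegrableOn ((Ioi (1:ℝ)).indicator (fun _ => (1:ℂ))) (Ioi 0) :=
    ((locallyIntegrable_const (1:ℂ)).indicator measurableSet_Ioi).locallyIntegrableOn _
  refine (h1.sub h2).congr ?_ 
  refine Filter.Eventually.of_forall fun t => ?_
  by_cases h : t ∈ Ioi (1:ℝ) <;> simp [fker, h]

lemma fker_bot : (fun t => (fker t : ℂ)) =O[nhdsWithin 0 (Ioi 0)] (fun t : ℝ => t ^ (-(-1) : ℝ)) := by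
  apply Asymptotics.IsBigO.of_bound 7
  filter_upwards [Ioo_mem_nhdsGT (zero_lt_one : (0:ℝ) < 1)] with t ht
  have h1 : t ∉ Ioi (1:ℝ) := by simp [ht.2.le]
  simp only [fker, h1, not_false_eq_true, indicator_of_notMem, sub_zero, neg_neg, Real.rpow_one,
    Complex.norm_real, Real.norm_eq_abs]
  rw [abs_of_pos ht.1]
  exact PhiInf_small ht.1 ht.2.le

lemma fker_top (k : ℕ) : (fun t => (fker t : ℂ)) =O[atTop] (fun t : ℝ => t ^ (-(k:ℝ))) := by
  apply Asymptotics.IsBigO.of_bound (22 * ((k+2:ℕ):ℝ)^(k+2))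
  filter_upwards [eventually_gt_atTop 1] with t ht
  have h1 : t ∈ Ioi (1:ℝ) := ht
  have h0 : 0 < t := by linarith
  simp only [fker, h1, indicator_of_mem, Complex.norm_real, Real.norm_eq_abs]
  rw [abs_of_pos (Real.rpow_pos_of_pos h0 _), Real.rpow_neg h0.le, Real.rpow_natCast]
  refine (PhiInf_large (M := k+2) (by omega) ht.le).trans (le_of_eq ?_)
  rw [pow_add t]; field_simp

lemma mellinConv_fker {w : ℂ} (hw : -1 < w.re) : MellinConvergent (fun t => (fker t : ℂ)) w := by
  obtain ⟨k, hk⟩ := exists_nat_gt w.re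
  exact mellinConvergent_of_isBigO_rpow locInt_fker (fker_top k) hk fker_bot hw

lemma mellinDiff_fker {w : ℂ} (hw : -1 < w.re) : DifferentiableAt ℂ (mellin (fun t => (fker t : ℂ))) w := by
  obtain ⟨k, hk⟩ := exists_nat_gt w.re
  exact mellin_differentiableAt_of_isBigO_rpow locInt_fker (fker_top k) hk fker_bot hw

lemma mellin_fker_eq {w : ℂ} (hw : 1 < w.re) :
    mellin (fun t => (fker t : ℂ)) w = (1-w)*(2-w)*Complex.Gamma w * riemannZeta w + 1 / w := by
  have h1 := hasMellin_one_Ioc (s := w) (by linarith)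
  have h2 := mellinConv_fker (w := w) (by linarith)
  have h3 := (hasMellin_sub h2 h1.1).2
  rw [h1.2] at h3
  have : mellin (fun t => (fker t : ℂ) - (Ioc 0 1).indicator (fun _ => 1 : ℝ → ℂ) t) w =
      mellin (fun t => ((PhiInf t - 1 : ℝ) : ℂ)) w := by
    refine setIntegral_congr_fun measurableSet_Ioi fun t ht => ?_
    have ht : 0 < t := ht
    by_cases h : t ≤ 1
    · simp [fker, ht, h]
    · have h' : 1 < t := not_le.1 h
      simp [fker, h, h']
  rw [this, mellin_PhiInf hw] at h3
  rw [h3]; ring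

lemma zeta_sq_analytic (w : ℂ) : AnalyticAt ℂ (fun z => (z-1) * ((z-1) * riemannZeta z)) w := by
  by_cases hw : w = 1
  · subst hw
    apply Complex.analyticAt_of_differentiable_on_punctured_nhds_of_continuousAt
    · filter_upwards [self_mem_nhdsWithin] with z hz
      have hz : z ≠ 1 := hz
      have := differentiableAt_riemannZeta hz
      fun_prop
    · rw [continuousAt_iff_punctured_nhds]
      have h1 : Tendsto (fun z : ℂ => z - 1) (nhdsWithin 1 {1}ᶜ) (nhds 0) := by
        have : Continuous (fun z : ℂ => z - 1) := by fun_prop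
        have := (this.tendsto 1).mono_left (nhdsWithin_le_nhds (s := {1}ᶜ))
        simpa using this
      simpa using h1.mul riemannZeta_residue_one
  · have : ∀ᶠ z in nhds w, DifferentiableAt ℂ (fun z => (z-1) * ((z-1) * riemannZeta z)) z := by
      filter_upwards [isOpen_ne.mem_nhds hw] with z hz
      have := differentiableAt_riemannZeta hz
      fun_prop
    exact Complex.analyticAt_iff_eventually_differentiableAt.2 this

lemma mellin_fker_cont {w : ℂ} (hw : -1 < w.re) (h0 : w ≠ 0) (h1 : w ≠ 1) :
    mellin (fun t => (fker t : ℂ)) w - 1 / w = (1-w)*(2-w)*Complex.Gamma w * riemannZeta w := by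
  set U : Set ℂ := {z | -1 < z.re} with hU
  have hUo : IsOpen U := isOpen_lt continuous_const Complex.continuous_re
  have hUc : IsPreconnected U := (convex_halfSpace_re_gt (-1)).isPreconnected
  have hA : AnalyticOnNhd ℂ (fun z => (z-1) * (z * mellin (fun t => (fker t : ℂ)) z - 1)) U := by
    apply DifferentiableOn.analyticOnNhd _ hUo
    intro z hz
    have := mellinDiff_fker (w := z) hz
    exact DifferentiableAt.differentiableWithinAt (by fun_prop)
  have hB : AnalyticOnNhd ℂ (fun z => Complex.Gamma (z+1) * (z - 2) * ((z-1) * ((z-1) * riemannZeta z))) U := by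
    have hG : AnalyticOnNhd ℂ (fun z => Complex.Gamma (z+1) * (z - 2)) U := by
      apply DifferentiableOn.analyticOnNhd _ hUo
      intro z hz
      have hz : -1 < z.re := hz
      have : DifferentiableAt ℂ (fun z => Complex.Gamma (z+1)) z := by
        have : DifferentiableAt ℂ Complex.Gamma (z+1) := by
          apply Complex.differentiableAt_Gamma
          intro m h
          have := congrArg Complex.re h
          simp at this
          have : (0:ℝ) ≤ m := m.cast_nonneg
          linarith
        exact this.comp z (by fun_prop)
      exact DifferentiableAt.differentiableWithinAt (by fun_prop)
    exact hG.mul fun z _ => zeta_sq_analytic z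
  have h2 : (2:ℂ) ∈ U := by simp [hU]; norm_num
  have hev : (fun z => (z-1) * (z * mellin (fun t => (fker t : ℂ)) z - 1)) =ᶠ[nhds 2]
      (fun z => Complex.Gamma (z+1) * (z - 2) * ((z-1) * ((z-1) * riemannZeta z))) := by
    have : {z : ℂ | 1 < z.re} ∈ nhds (2:ℂ) :=
      (isOpen_lt continuous_const Complex.continuous_re).mem_nhds (by simp)
    filter_upwards [this] with z hz
    have hz : 1 < z.re := hz
    have hz0 : z ≠ 0 := by rintro rfl; simp at hz; linarith
    rw [mellin_fker_eq hz, Complex.Gamma_add_one _ hz0]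
    field_simp
    ring
  have := hA.eqOn_of_preconnected_of_eventuallyEq hB hUc h2 hev hw
  simp only at this
  rw [Complex.Gamma_add_one _ h0] at this
  have h1' : w - 1 ≠ 0 := sub_ne_zero.2 h1
  have h3 : w * mellin (fun t => (fker t : ℂ)) w - 1 = w * Complex.Gamma w * (w-2) * ((w-1) * riemannZeta w) := by
    apply mul_left_cancel₀ h1'
    rw [this]; ring
  apply mul_left_cancel₀ h0
  rw [mul_sub, mul_one_div_cancel h0, h3]; ring

lemma real_fker {w : ℝ} (hw : -1 < w) (h0 : w ≠ 0) (h1 : w ≠ 1) :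
    (∫ t in Ioi (0:ℝ), t^(w-1) * fker t) - 1 / w =
      (1-w)*(2-w)*Real.Gamma w * (riemannZeta (w:ℂ)).re := by
  have h := mellin_fker_cont (w := (w:ℂ)) (by simpa using hw) (by exact_mod_cast h0) (by exact_mod_cast h1)
  have e : mellin (fun t => (fker t : ℂ)) (w:ℂ) = ((∫ t in Ioi (0:ℝ), t^(w-1) * fker t : ℝ) : ℂ) := by
    rw [mellin, ← integral_complex_ofReal]
    refine setIntegral_congr_fun measurableSet_Ioi fun t ht => ?_
    have ht : 0 < t := ht
    simp only [smul_eq_mul]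
    push_cast
    rw [Complex.ofReal_cpow ht.le]; push_cast; rfl
  rw [e, Complex.Gamma_ofReal] at h
  have h' := congrArg Complex.re h
  have e2 : (1-(w:ℂ))*(2-w)*(Real.Gamma w : ℂ) = (((1-w)*(2-w)*Real.Gamma w : ℝ) : ℂ) := by push_cast; ring
  have e3 : ((∫ t in Ioi (0:ℝ), t^(w-1) * fker t : ℝ) : ℂ) - 1 / (w:ℂ) = (((∫ t in Ioi (0:ℝ), t^(w-1) * fker t) - 1/w : ℝ) : ℂ) := by push_cast; ring
  rw [e2, e3, Complex.re_ofReal_mul, Complex.ofReal_re] at h'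
  exact h'

noncomputable def Fker (s : ℝ) (N : ℕ) (y : ℝ) : ℝ :=
  y ^ (-s/2) * (1+y/N) ^ (s/2) *
    (Phi N (y/N) - (Ioi (1:ℝ)).indicator (fun _ => (1:ℝ)) y * ((1+y/N)^2)⁻¹)

lemma measurable_Fker (s : ℝ) (N : ℕ) : Measurable (Fker s N) := by
  have h : Measurable ((Ioi (1:ℝ)).indicator (fun _ => (1:ℝ))) := measurable_const.indicator measurableSet_Ioi
  unfold Fker Phi
  fun_prop

noncomputable def bker (s C : ℝ) (y : ℝ) : ℝ :=
  (Ioc (0:ℝ) 1).indicator (fun y => 28 * y ^ (1 - s/2)) y + (Ioi (1:ℝ)).indicator (fun y => C * y ^ (-2:ℝ)) y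

lemma integrable_bker {s : ℝ} (hs4 : s < 4) (C : ℝ) : Integrable (bker s C) (volume.restrict (Ioi 0)) := by
  apply Integrable.add
  · apply Integrable.restrict
    rw [integrable_indicator_iff measurableSet_Ioc]
    apply Integrable.const_mul
    have := intervalIntegral.intervalIntegrable_rpow' (a := 0) (b := 1) (r := 1 - s/2) (by linarith)
    rwa [intervalIntegrable_iff_integrableOn_Ioc_of_le zero_le_one] at this
  · apply Integrable.restrict
    rw [integrable_indicator_iff measurableSet_Ioi]
    apply Integrable.const_mul
    exact integrableOn_Ioi_rpow_of_lt (by norm_num) (by norm_num)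

lemma weight_bound {s : ℝ} (hs4 : s < 4) {N : ℕ} (hN : 1 ≤ N) {y : ℝ} (hy : 0 < y) :
    (1+y/N) ^ (s/2) ≤ (1+y)^2 := by
  have hN0 : (1:ℝ) ≤ N := by exact_mod_cast hN
  have h1 : 0 ≤ y/N := by positivity
  have h2 : y/N ≤ y := div_le_self hy.le hN0
  calc (1+y/N) ^ (s/2) ≤ (1+y/N)^(2:ℝ) := Real.rpow_le_rpow_of_exponent_le (by linarith) (by linarith)
    _ = (1+y/N)^2 := by norm_cast
    _ ≤ _ := by gcongr

lemma Fker_bound {s : ℝ} (hs4 : s < 4) {M N : ℕ} (hM : 1 ≤ M) (hMs : 6 - s/2 ≤ M) (hN : 2 ≤ N) (hMN : M ≤ N)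
    {y : ℝ} (hy : 0 < y) : ‖Fker s N y‖ ≤ bker s (88 * M^M) y := by
  have hN0 : (0:ℝ) < N := by exact_mod_cast (by omega : 0 < N)
  have hw := weight_bound hs4 (by omega : 1 ≤ N) hy
  have e : (N:ℝ) * (y/N) = y := mul_div_cancel₀ _ hN0.ne'
  have hx : 0 < y/N := by positivity
  have hy1 : 0 < y ^ (-s/2) := Real.rpow_pos_of_pos hy _
  have hw0 : 0 < (1+y/N) ^ (s/2) := Real.rpow_pos_of_pos (by linarith) _
  unfold Fker bker
  rw [norm_mul, norm_mul, Real.norm_eq_abs, Real.norm_eq_abs, Real.norm_eq_abs, abs_of_pos hy1, abs_of_pos hw0]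
  by_cases h : y ≤ 1
  · have h1 : y ∉ Ioi (1:ℝ) := by simp [h]
    have h2 : y ∈ Ioc (0:ℝ) 1 := ⟨hy, h⟩
    rw [indicator_of_notMem h1, indicator_of_notMem h1, indicator_of_mem h2, zero_mul, sub_zero, add_zero]
    have hP := Phi_small (N := N) hx (by omega) (by rw [e]; exact h)
    rw [e] at hP
    have h4 : (1+y)^2 ≤ 4 := by nlinarith
    calc _ ≤ y ^ (-s/2) * 4 * (7*y) := by
          gcongr; linarith
      _ = 28 * (y ^ (-s/2) * y^(1:ℝ)) := by rw [Real.rpow_one]; ring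
      _ = _ := by rw [← Real.rpow_add hy]; congr 2; ring
  · have h' : 1 < y := not_le.1 h
    have h1 : y ∈ Ioi (1:ℝ) := h'
    have h2 : y ∉ Ioc (0:ℝ) 1 := fun h3 => h h3.2
    rw [indicator_of_mem h1, indicator_of_mem h1, indicator_of_notMem h2, one_mul, zero_add]
    have hP := Phi_large' hM hN hMN h'.le
    have h4 : (1+y)^2 ≤ 4*y^2 := by nlinarith
    calc _ ≤ y ^ (-s/2) * (4*y^2) * (22 * M^M * y^2 / y^M) := by
          gcongr; linarith
      _ = 88 * M^M * (y ^ (-s/2) * y^(4:ℝ) / y^(M:ℝ)) := by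
          rw [Real.rpow_natCast, show y^(4:ℝ) = y^4 by norm_cast]; ring
      _ ≤ _ := by
          rw [← Real.rpow_add hy, ← Real.rpow_sub hy]
          gcongr
          · exact h'.le
          · linarith

lemma Fker_tendsto {s : ℝ} {y : ℝ} (hy : 0 < y) :
    Tendsto (fun N : ℕ => Fker s N y) atTop (nhds (y ^ (-s/2) * fker y)) := by
  have h0 : Tendsto (fun N : ℕ => 1 + y/(N:ℝ)) atTop (nhds 1) := by
    simpa using (tendsto_const_div_atTop_nhds_zero_nat y).const_add 1
  have hz : Tendsto (fun N : ℕ => ((1 + y/(N:ℝ))^2)⁻¹) atTop (nhds 1) := by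
    simpa using (h0.pow 2).inv₀ (by norm_num)
  have h1 : Tendsto (fun N : ℕ => (1 + y/(N:ℝ))^(s/2)) atTop (nhds 1) := by
    simpa using h0.rpow_const (p := s/2) (Or.inl one_ne_zero)
  have := (h1.const_mul (y^(-s/2))).mul ((Phi_tendsto hy).sub (hz.const_mul ((Ioi (1:ℝ)).indicator (fun _ => (1:ℝ)) y)))
  simpa [Fker, fker] using this

lemma exists_M (s : ℝ) : ∃ M : ℕ, 1 ≤ M ∧ 6 - s/2 ≤ (M:ℝ) := by
  obtain ⟨M, hM⟩ := exists_nat_ge (6 - s/2)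
  exact ⟨M+1, by omega, by push_cast; linarith⟩

lemma Fker_int_tendsto {s : ℝ} (hs4 : s < 4) :
    Tendsto (fun N : ℕ => ∫ y in Ioi (0:ℝ), Fker s N y) atTop
      (nhds (∫ y in Ioi (0:ℝ), y ^ (-s/2) * fker y)) := by
  obtain ⟨M, hM, hMs⟩ := exists_M s
  apply tendsto_integral_filter_of_dominated_convergence (bker s (88 * M^M))
  · exact Eventually.of_forall fun N => (measurable_Fker s N).aestronglyMeasurable
  · filter_upwards [eventually_ge_atTop 2, eventually_ge_atTop M] with N hN hMN
    exact (ae_restrict_mem measurableSet_Ioi).mono fun y hy => Fker_bound hs4 hM hMs hN hMN hy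
  · exact integrable_bker hs4 _
  · exact (ae_restrict_mem measurableSet_Ioi).mono fun y hy => Fker_tendsto hy

lemma Fker_integrable {s : ℝ} (hs4 : s < 4) :
    ∀ᶠ N : ℕ in atTop, IntegrableOn (Fker s N) (Ioi 0) := by
  obtain ⟨M, hM, hMs⟩ := exists_M s
  filter_upwards [eventually_ge_atTop 2, eventually_ge_atTop M] with N hN hMN
  exact (integrable_bker hs4 (88 * M^M)).mono' (measurable_Fker s N).aestronglyMeasurable
    ((ae_restrict_mem measurableSet_Ioi).mono fun y hy => Fker_bound hs4 hM hMs hN hMN hy)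

lemma main_int {s : ℝ} (hs2 : s ≠ 2) {N : ℕ} (hN : 1 ≤ N) :
    IntegrableOn (fun y : ℝ => y ^ (-s/2) * (1+y/N) ^ (s/2) * ((1+y/N)^2)⁻¹) (Ioi 1) ∧
    ∫ y in Ioi (1:ℝ), y ^ (-s/2) * (1+y/N) ^ (s/2) * ((1+y/N)^2)⁻¹ =
      (N:ℝ)^(1-s/2) / (1-s/2) - (1/(1+1/(N:ℝ)))^(1-s/2)/(1-s/2) := by
  have hN0 : (0:ℝ) < N := by exact_mod_cast (by omega : 0 < N)
  have hw : 1 - s/2 ≠ 0 := fun h => hs2 (by linarith)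
  have hd : ∀ y ∈ Ici (1:ℝ), HasDerivAt (fun y : ℝ => (y/(1+y/N))^(1-s/2)/(1-s/2))
      (y ^ (-s/2) * (1+y/N) ^ (s/2) * ((1+y/N)^2)⁻¹) y := by
    intro y hy
    have hy0 : 0 < y := lt_of_lt_of_le one_pos hy
    have hp : 0 < 1 + y/N := by positivity
    have h1 : HasDerivAt (fun y : ℝ => y/(1+y/N)) (((1+y/N)^2)⁻¹) y := by
      have a := (((hasDerivAt_id y).div_const (N:ℝ)).const_add 1)
      have := (hasDerivAt_id y).div a hp.ne'
      convert! this using 1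
      simp only [id]; field_simp; ring
    have h2 := (h1.rpow_const (p := 1-s/2) (Or.inl (by positivity))).div_const (1-s/2)
    convert! h2 using 1
    have : 1 - s/2 - 1 = -s/2 := by ring
    rw [this, Real.div_rpow hy0.le hp.le, show -s/2 = -(s/2) by ring, Real.rpow_neg hp.le (s/2)]
    have := (Real.rpow_pos_of_pos hp (s/2)).ne'
    field_simp
  have hpos : ∀ y ∈ Ioi (1:ℝ), 0 ≤ y ^ (-s/2) * (1+y/N) ^ (s/2) * ((1+y/N)^2)⁻¹ := by
    intro y hy
    have hy0 : 0 < y := lt_trans one_pos hy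
    positivity
  have hl : Tendsto (fun y : ℝ => (y/(1+y/N))^(1-s/2)/(1-s/2)) atTop (nhds ((N:ℝ)^(1-s/2) / (1-s/2))) := by
    have h1 : Tendsto (fun y : ℝ => y/(1+y/N)) atTop (nhds (N:ℝ)) := by
      have : Tendsto (fun y : ℝ => (y⁻¹ + (N:ℝ)⁻¹)⁻¹) atTop (nhds (N:ℝ)) := by
        have := (tendsto_inv_atTop_zero.add_const ((N:ℝ)⁻¹)).inv₀ (by simp; omega)
        simpa using this
      refine this.congr' ?_
      filter_upwards [eventually_gt_atTop 0] with y hy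
      field_simp
    exact (h1.rpow_const (Or.inl hN0.ne')).div_const _
  exact ⟨integrableOn_Ioi_deriv_of_nonneg' hd hpos hl, integral_Ioi_of_hasDerivAt_of_nonneg' hd hpos hl⟩

lemma scaled_int {s : ℝ} (hs2 : s ≠ 2) {N : ℕ} (hN : 1 ≤ N) (hF : IntegrableOn (Fker s N) (Ioi 0)) :
    ∫ x in Ioi (0:ℝ), x ^ (-s/2) * (1+x) ^ (s/2) * Phi N x =
      (N:ℝ)^(s/2-1) * ((∫ y in Ioi (0:ℝ), Fker s N y) +
        ((N:ℝ)^(1-s/2) / (1-s/2) - (1/(1+1/(N:ℝ)))^(1-s/2)/(1-s/2))) := by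
  have hN0 : (0:ℝ) < N := by exact_mod_cast (by omega : 0 < N)
  obtain ⟨m1, m2⟩ := main_int hs2 hN
  rw [← m2]
  have hsub : Ioi (1:ℝ) ⊆ Ioi 0 := Ioi_subset_Ioi zero_le_one
  set G : ℝ → ℝ := fun y => y ^ (-s/2) * (1+y/N) ^ (s/2) * ((1+y/N)^2)⁻¹ with hG
  have e1 : ∫ y in Ioi (1:ℝ), G y = ∫ y in Ioi (0:ℝ), (Ioi (1:ℝ)).indicator G y := by
    rw [setIntegral_indicator measurableSet_Ioi, inter_eq_self_of_subset_right hsub]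
  have i1 : IntegrableOn ((Ioi (1:ℝ)).indicator G) (Ioi 0) :=
    ((integrable_indicator_iff measurableSet_Ioi).2 m1).integrableOn
  rw [e1, ← integral_add hF i1]
  have e2 := integral_comp_mul_left_Ioi (fun x : ℝ => x ^ (-s/2) * (1+x) ^ (s/2) * Phi N x) 0 (inv_pos.2 hN0)
  rw [mul_zero, inv_inv, smul_eq_mul] at e2
  have e3 : ∫ y in Ioi (0:ℝ), ((N:ℝ)⁻¹ * y) ^ (-s/2) * (1+(N:ℝ)⁻¹ * y) ^ (s/2) * Phi N ((N:ℝ)⁻¹ * y) =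
      (N:ℝ)^(s/2) * ∫ y in Ioi (0:ℝ), (Fker s N y + (Ioi (1:ℝ)).indicator G y) := by
    rw [← integral_const_mul]
    refine setIntegral_congr_fun measurableSet_Ioi fun y hy => ?_
    have hy : 0 < y := hy
    have q : (N:ℝ)⁻¹ * y = y/N := by rw [div_eq_inv_mul]
    have q2 : (y/N)^(-s/2) = (N:ℝ)^(s/2) * y^(-s/2) := by
      rw [Real.div_rpow hy.le hN0.le, show -s/2 = -(s/2) by ring, Real.rpow_neg hN0.le, div_inv_eq_mul, mul_comm]
    simp only [q]
    rw [q2]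
    by_cases h : y ∈ Ioi (1:ℝ)
    · simp only [Fker, hG, indicator_of_mem h]; ring
    · simp only [Fker, indicator_of_notMem h]; ring
  rw [e3] at e2
  rw [Real.rpow_sub hN0, Real.rpow_one, div_mul_eq_mul_div, e2]
  field_simp

/-- For `s < 4`, `s ≠ 0`, `s ≠ 2`, the expected Riesz `s`-energy satisfies
`(I_s(N) − (2^{1−s}/(2−s))N²)/N^{1+s/2} → C(s)` as `N → ∞`. -/
theorem expected_riesz_energy_second_order (s : ℝ) (hs4 : s < 4) (hs0 : s ≠ 0) (hs2 : s ≠ 2) :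
    Tendsto (fun N : ℕ =>
        (Ienergy s N - 2 ^ (1-s) / (2-s) * (N:ℝ)^2) / (N:ℝ) ^ (1 + s/2))
      atTop (nhds (Cconst s)) := by
  have hw : 1 - s/2 ≠ 0 := fun h => hs2 (by linarith)
  have h2s : 2 - s ≠ 0 := fun h => hs2 (by linarith)
  have hR := real_fker (w := 1 - s/2) (by linarith) hw (fun h => hs0 (by linarith))
  have hlim : Tendsto (fun N : ℕ => (2:ℝ)^(-s) * ((∫ y in Ioi (0:ℝ), Fker s N y) -
      (1/(1+1/(N:ℝ)))^(1-s/2)/(1-s/2))) atTop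
      (nhds ((2:ℝ)^(-s) * ((∫ y in Ioi (0:ℝ), y ^ (-s/2) * fker y) - 1/(1-s/2)))) := by
    apply Tendsto.const_mul
    apply (Fker_int_tendsto hs4).sub
    have h0 : Tendsto (fun N : ℕ => 1/(1 + 1/(N:ℝ))) atTop (nhds 1) := by
      have := ((tendsto_const_div_atTop_nhds_zero_nat (1:ℝ)).const_add 1).inv₀ (by norm_num)
      simpa using this
    simpa using (h0.rpow_const (p := 1-s/2) (Or.inl one_ne_zero)).div_const (1-s/2)
  have hC : (2:ℝ)^(-s) * ((∫ y in Ioi (0:ℝ), y ^ (-s/2) * fker y) - 1/(1-s/2)) = Cconst s := by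
    have e : 1 - s/2 - 1 = -s/2 := by ring
    rw [e] at hR
    rw [hR, Cconst]; ring
  rw [hC] at hlim
  refine hlim.congr' ?_
  filter_upwards [Fker_integrable hs4, eventually_ge_atTop 1] with N hF hN
  have hN0 : (0:ℝ) < N := by exact_mod_cast (by omega : 0 < N)
  rw [Ienergy, scaled_int hs2 hN hF]
  generalize (∫ y in Ioi (0:ℝ), Fker s N y) = A
  generalize (1/(1+1/(N:ℝ)))^(1-s/2) = B
  have p1 : (N:ℝ)^(1+s/2) = N * N^(s/2) := by rw [Real.rpow_add hN0, Real.rpow_one]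
  have p2 : (N:ℝ)^(s/2-1) = N^(s/2) / N := by rw [Real.rpow_sub hN0, Real.rpow_one]
  have p3 : (N:ℝ)^(1-s/2) = N / N^(s/2) := by rw [Real.rpow_sub hN0, Real.rpow_one]
  have p4 : (2:ℝ)^(1-s) = 2 / 2^s := by rw [Real.rpow_sub two_pos, Real.rpow_one]
  have p5 : (2:ℝ)^(-s) = (2^s)⁻¹ := Real.rpow_neg two_pos.le _
  rw [p1, p2, p3, p4, p5]
  have hX : (N:ℝ)^(s/2) ≠ 0 := (Real.rpow_pos_of_pos hN0 _).ne'
  have hT : (2:ℝ)^s ≠ 0 := (Real.rpow_pos_of_pos two_pos _).ne'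
  generalize (N:ℝ)^(s/2) = X at *
  generalize (2:ℝ)^s = T at *
  have hs : s = 2 - 2 * (1 - s/2) := by ring
  generalize 1 - s/2 = w at *
  subst hs
  have : 2 - (2 - 2 * w) = 2 * w := by ring
  rw [this]
  field_simp
  ring
end

section
/- Let N ≥ 2 be an integer and let s > 0 be a real number. Then ∫₀^s Φ_N(x) dx = s/(1+s) − 1/N + s(2+s)/( (1+s)·((1+s)^N − 1) ) − N s² (1+s)^N / ( (1+s)·((1+s)^N − 1)² ). (Under the substitution s = t²/(4−t²) this gives the exact expected number of pairs of zeros of a random elliptic polynomial at spherical chordal distance at most t.) -/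
open MeasureTheory Set

theorem aux_deriv (M : ℕ) (x : ℝ) (hx : 0 < x) :
    HasDerivAt (fun s : ℝ => s/(1+s) - 1/((M+2 : ℕ) : ℝ) + s*(2+s) / ((1+s) * ((1+s)^(M+2) - 1))
        - ((M+2 : ℕ) : ℝ) * s^2 * (1+s)^(M+2) / ((1+s) * ((1+s)^(M+2) - 1)^2)) (Phi (M+2) x) x := by
  have hu : (1+x) ≠ 0 := by positivity
  have hP : (1+x)^(M+2) - 1 ≠ 0 :=
    ne_of_gt (sub_pos.2 (one_lt_pow₀ (by linarith) (by omega)))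
  have h1 : HasDerivAt (fun s : ℝ => 1 + s) 1 x := by
    simpa using (hasDerivAt_id x).const_add 1
  have h2 : HasDerivAt (fun s : ℝ => 2 + s) 1 x := by
    simpa using (hasDerivAt_id x).const_add 2
  have hid : HasDerivAt (fun s : ℝ => s) 1 x := hasDerivAt_id x
  have hp : HasDerivAt (fun s : ℝ => (1+s)^(M+2)) (((M+2 : ℕ) : ℝ) * (1+x)^(M+1)) x := by
    simpa using h1.fun_pow (M+2)
  have hq := hp.sub_const 1
  have hsq : HasDerivAt (fun s : ℝ => s^2) (2*x) x := by
    simpa using hid.fun_pow 2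
  have hq2 : HasDerivAt (fun s : ℝ => ((1+s)^(M+2) - 1)^2)
      (2*((1+x)^(M+2) - 1) * (((M+2 : ℕ) : ℝ) * (1+x)^(M+1))) x := by
    simpa using hq.fun_pow 2
  have key := (((hid.fun_div h1 hu).sub_const (1/((M+2 : ℕ) : ℝ))).fun_add
    ((hid.fun_mul h2).fun_div (h1.fun_mul hq) (mul_ne_zero hu hP))).fun_sub
    (((hsq.const_mul ((M+2 : ℕ) : ℝ)).fun_mul hp).fun_div (h1.fun_mul hq2)
      (mul_ne_zero hu (pow_ne_zero 2 hP)))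
  refine key.congr_deriv ?_
  clear key hq2 hsq hq hp hid h2 h1
  unfold Phi
  have e1 : M + 2 - 2 = M := by omega
  have e2 : M + 2 - 1 = M + 1 := by omega
  rw [e1, e2]
  generalize ((M+2 : ℕ) : ℝ) = n
  have p1 : (1+x)^(M+1) = (1+x)^M * (1+x) := pow_succ _ _
  have p2 : (1+x)^(M+2) = (1+x)^M * (1+x)^2 := pow_add _ _ _
  rw [p2] at hP
  rw [p1, p2]
  clear p1 p2
  generalize (1+x)^M = a at *
  obtain ⟨u, rfl⟩ : ∃ u, x = u - 1 := ⟨1+x, by ring⟩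
  have e3 : 1 + (u - 1) = u := by ring
  rw [e3] at hu hP ⊢
  obtain ⟨D, hD⟩ : ∃ D, D = a * u^2 - 1 := ⟨_, rfl⟩
  rw [← hD] at hP ⊢
  field_simp
  subst hD
  ring

theorem integral_Phi_closed_form (N : ℕ) (hN : 2 ≤ N) (s : ℝ) (hs : 0 < s) :
    ∫ x in (0:ℝ)..s, Phi N x =
      s/(1+s) - 1/N + s*(2+s) / ((1+s) * ((1+s)^N - 1))
        - N * s^2 * (1+s)^N / ((1+s) * ((1+s)^N - 1)^2) := by
  obtain ⟨M, rfl⟩ : ∃ M, N = M + 2 := ⟨N - 2, by omega⟩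
  let S : ℝ → ℝ := fun x => ∑ i ∈ Finset.range (M+2), (1+x)^i
  have hSpos : ∀ x, 0 ≤ x → 0 < S x := fun x hx =>
    Finset.sum_pos (fun i _ => by positivity) ⟨0, by simp⟩
  have hSx : ∀ x, (1+x)^(M+2) - 1 = x * S x := fun x => by
    have := geom_sum_mul (1+x) (M+2)
    simp only [S]; rw [← this]; ring
  have hScont : Continuous S := by simp only [S]; fun_prop
  let G : ℝ → ℝ := fun s => s/(1+s) - 1/((M+2 : ℕ) : ℝ) + (2+s) / ((1+s) * S s)
        - ((M+2 : ℕ) : ℝ) * (1+s)^(M+2) / ((1+s) * (S s)^2)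
  have hG : ∀ x, 0 < x → x/(1+x) - 1/((M+2 : ℕ) : ℝ) + x*(2+x) / ((1+x) * ((1+x)^(M+2) - 1))
        - ((M+2 : ℕ) : ℝ) * x^2 * (1+x)^(M+2) / ((1+x) * ((1+x)^(M+2) - 1)^2) = G x := by
    intro x hx
    have h1 := (hSpos x hx.le).ne'
    have h2 : 1 + x ≠ 0 := by positivity
    rw [hSx]
    simp only [G]
    generalize (1+x)^(M+2) = p
    congr 1
    · congr 1
      field_simp
    · field_simp
  have hG0 : G 0 = 0 := by
    have : S 0 = ((M+2 : ℕ) : ℝ) := by simp [S]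
    have hn : ((M+2 : ℕ) : ℝ) ≠ 0 := by positivity
    simp only [G]
    rw [this]
    generalize ((M+2 : ℕ) : ℝ) = n at *
    simp
    field_simp
    ring
  have hGc : ContinuousOn G (Icc 0 s) := by
    intro x hx
    have h1 := (hSpos x hx.1).ne'
    have h2 : 1 + x ≠ 0 := by have := hx.1; positivity
    apply ContinuousAt.continuousWithinAt
    have hc := hScont.continuousAt (x := x)
    simp only [G]
    fun_prop (disch := positivity)
  have hd : ∀ x ∈ Ioo 0 s, HasDerivAt G (Phi (M+2) x) x := by
    intro x hx
    refine (aux_deriv M x hx.1).congr_of_eventuallyEq ?_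
    filter_upwards [lt_mem_nhds hx.1] with y hy
    exact (hG y hy).symm
  have hnn : ∀ x ∈ Ioo 0 s, 0 ≤ Phi (M+2) x := by
    intro x hx
    have := hx.1
    have h := hSpos x this.le
    unfold Phi
    rw [hSx]
    positivity
  have hint := intervalIntegral.integrableOn_deriv_of_nonneg hGc hd hnn
  rw [hG s hs, intervalIntegral.integral_eq_sub_of_hasDerivAt_of_le hs.le hGc hd
    ((intervalIntegrable_iff_integrableOn_Ioc_of_le hs.le).2 hint), hG0, sub_zero]
end

section
/- Let N ≥ 2 be an integer and let s ≥ 0 be a real number. Then s²·N²·((1+s)^N − 1)² + 4(1+s)·( (1+s)^N − 1 − Ns )·( (1+s)^N − 1 − Ns − (N−1)s·((1+s)^N − 1) ) ≥ 0. (This inequality is equivalent to the bound E[G(t,X_N)] ≤ N³t⁴/128 on the expected number of close pairs of zeros of a random elliptic polynomial, with s = t²/(4−t²).) -/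
/-- The polynomial inequality equivalent to the bound `E[G(t,X_N)] ≤ N³t⁴/128`. -/
theorem separation_polynomial_nonneg (N : ℕ) (hN : 2 ≤ N) (s : ℝ) (hs : 0 ≤ s) :
    0 ≤ s^2 * (N:ℝ)^2 * ((1+s)^N - 1)^2
      + 4*(1+s) * ((1+s)^N - 1 - N*s)
        * ((1+s)^N - 1 - N*s - (N-1)*s*((1+s)^N - 1)) := by
  have hP : s ≤ (1+s)^N - 1 := by
    have h := le_self_pow₀ (show (1:ℝ) ≤ 1 + s by linarith) (show N ≠ 0 by omega)
    linarith
  generalize (1+s)^N - 1 = P at hP ⊢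
  -- AM-GM: 4 (1+s) A C ≤ ((1+s) A + C)^2 with A = P - N s, C = (N-1) s P - A
  have key : s^2 * (N:ℝ)^2 * P^2 + 4*(1+s) * (P - N*s) * (P - N*s - (N-1)*s*P)
      = s^2 * (N:ℝ)^2 * (s * (2*P - s))
        + ((1+s) * (P - N*s) - ((N-1)*s*P - (P - N*s)))^2 := by ring
  rw [key]
  have h2 : 0 ≤ s * (2*P - s) := mul_nonneg hs (by linarith)
  positivity
end

section
/- Let N ≥ 2 and m be integers with 0 ≤ m ≤ 2N − 2. Then (N−2)²·( C(2N, m+2) − 2·C(N, m+2) ) − 4(N−2)·( C(2N, m+3) − 2·C(N, m+3) − N·C(N, m+2) ) + 4·( C(2N, m+4) − 2·C(N, m+4) − 2N·C(N, m+3) ) − 4N·( C(N, m+2) − (N−1)·C(N, m+1) ) ≥ 0, where C(n,k) denotes the binomial coefficient (equal to 0 when k > n) and the inequality is in ℤ. -/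
lemma chs (n k : ℕ) : (Nat.choose n (k+1) : ℤ) * (k+1) = Nat.choose n k * ((n:ℤ) - k) := by
  rcases le_or_gt k n with h | h
  · have := Nat.choose_succ_right_eq n k
    zify [h] at this
    exact this
  · rw [Nat.choose_eq_zero_of_lt h, Nat.choose_eq_zero_of_lt (by omega : n < k+1)]
    simp

lemma chA (N k : ℕ) (hN : 2 ≤ N) (hk : 5 ≤ k) :
    0 ≤ ((N:ℤ) - 2)^2 * (Nat.choose (2*N) k : ℤ) - 4*((N:ℤ) - 2) * (Nat.choose (2*N) (k+1) : ℤ)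
      + 4 * (Nat.choose (2*N) (k+2) : ℤ) := by
  have h1 := chs (2*N) k
  have h2 := chs (2*N) (k+1)
  push_cast at h1 h2
  have h0 : (0:ℤ) ≤ Nat.choose (2*N) k := by positivity
  generalize (Nat.choose (2*N) k : ℤ) = a at *
  generalize (Nat.choose (2*N) (k+1) : ℤ) = b at *
  generalize (Nat.choose (2*N) (k+1+1) : ℤ) = c at *
  obtain ⟨t, rfl⟩ := Nat.exists_eq_add_of_le hN
  obtain ⟨j, rfl⟩ := Nat.exists_eq_add_of_le hk
  push_cast at *
  have hP : (0:ℤ) ≤ ((2+t:ℤ)^2*((5+j:ℤ)^2-5*(5+j)+2) - 4*((5+j:ℤ)-4)*(2+t)+8) := by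
    have : ((2+t:ℤ)^2*((5+j:ℤ)^2-5*(5+j)+2) - 4*((5+j:ℤ)-4)*(2+t)+8)
      = (2+t:ℤ)*(t*(j^2+5*j+2) + 2*j*(j+3)) + 8 := by ring
    rw [this]; positivity
  have key : (((2+t:ℤ) - 2)^2 * a - 4*((2+t:ℤ) - 2) * b + 4 * c) * (((5+j:ℤ)+1)*((5+j)+2))
     = a * ((2+t:ℤ)^2*((5+j:ℤ)^2-5*(5+j)+2) - 4*((5+j:ℤ)-4)*(2+t)+8) := by
    linear_combination (-4*((2+t:ℤ) - 2)*((5+j)+2) + 4*(2*(2+t:ℤ) - (5+j+1))) * h1 + 4*((5+j:ℤ)+1) * h2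
  have hpos : (0:ℤ) < ((5+j:ℤ)+1)*((5+j)+2) := by positivity
  exact nonneg_of_mul_nonneg_left (key ▸ mul_nonneg h0 hP) hpos

lemma chB (N k : ℕ) (hk : 5 ≤ k) :
    0 ≤ (2*(N:ℤ)^2 - 4*N - 8) * (Nat.choose N k : ℤ) - 16 * (Nat.choose N (k+1) : ℤ)
      - 8 * (Nat.choose N (k+2) : ℤ) := by
  rcases lt_or_ge N k with h | h
  · rw [Nat.choose_eq_zero_of_lt h, Nat.choose_eq_zero_of_lt (by omega : N < k+1),
      Nat.choose_eq_zero_of_lt (by omega : N < k+2)]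
    simp
  have h1 := chs N k
  have h2 := chs N (k+1)
  push_cast at h1 h2
  have h0 : (0:ℤ) ≤ Nat.choose N k := by positivity
  generalize (Nat.choose N k : ℤ) = a at *
  generalize (Nat.choose N (k+1) : ℤ) = b at *
  generalize (Nat.choose N (k+1+1) : ℤ) = c at *
  obtain ⟨t, rfl⟩ := Nat.exists_eq_add_of_le h
  obtain ⟨j, rfl⟩ := Nat.exists_eq_add_of_le hk
  push_cast at *
  have hP : (0:ℤ) ≤ (2*(5+j+t:ℤ)^2 - 4*(5+j+t) - 8)*((5+j+1)*(5+j+2)) - 16*t*(5+j+2) - 8*t*(t-1) := by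
    ring_nf; positivity
  have key : ((2*(5+j+t:ℤ)^2 - 4*(5+j+t) - 8) * a - 16 * b - 8 * c) * (((5+j:ℤ)+1)*((5+j)+2))
     = a * ((2*(5+j+t:ℤ)^2 - 4*(5+j+t) - 8)*((5+j+1)*(5+j+2)) - 16*t*(5+j+2) - 8*t*(t-1)) := by
    linear_combination (-16*((5+j:ℤ)+2) - 8*((t:ℤ)-1)) * h1 - 8*((5+j:ℤ)+1) * h2
  have hpos : (0:ℤ) < ((5+j:ℤ)+1)*((5+j)+2) := by positivity
  exact nonneg_of_mul_nonneg_left (key ▸ mul_nonneg h0 hP) hpos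

lemma chsmall (n : ℕ) : (Nat.choose n 1 : ℤ) = n ∧ 2 * (Nat.choose n 2 : ℤ) = n*(n-1) ∧
    6 * (Nat.choose n 3 : ℤ) = n*(n-1)*(n-2) ∧ 24 * (Nat.choose n 4 : ℤ) = n*(n-1)*(n-2)*(n-3) ∧
    120 * (Nat.choose n 5 : ℤ) = n*(n-1)*(n-2)*(n-3)*(n-4) ∧
    720 * (Nat.choose n 6 : ℤ) = n*(n-1)*(n-2)*(n-3)*(n-4)*(n-5) := by
  have h1 := chs n 1
  have h2 := chs n 2
  have h3 := chs n 3
  have h4 := chs n 4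
  have h5 := chs n 5
  norm_num at h1 h2 h3 h4 h5
  have e2 : 2 * (Nat.choose n 2 : ℤ) = n*(n-1) := by linarith
  have e3 : 6 * (Nat.choose n 3 : ℤ) = n*(n-1)*(n-2) := by
    linear_combination 2 * h2 + ((n:ℤ)-2) * e2
  have e4 : 24 * (Nat.choose n 4 : ℤ) = n*(n-1)*(n-2)*(n-3) := by
    linear_combination 6 * h3 + ((n:ℤ)-3) * e3
  have e5 : 120 * (Nat.choose n 5 : ℤ) = n*(n-1)*(n-2)*(n-3)*(n-4) := by
    linear_combination 24 * h4 + ((n:ℤ)-4) * e4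
  exact ⟨by simp, e2, e3, e4, e5, by linear_combination 120 * h5 + ((n:ℤ)-5) * e5⟩

/-- Nonnegativity of the coefficients `c_{N,m}` of the polynomial `g_N(s) = f_N(s)/s⁴`. -/
theorem coefficients_nonneg (N : ℕ) (hN : 2 ≤ N) (m : ℕ) (hm : m ≤ 2*N - 2) :
    0 ≤ ((N:ℤ) - 2)^2 * ((Nat.choose (2*N) (m+2) : ℤ) - 2 * Nat.choose N (m+2))
      - 4*((N:ℤ) - 2) * ((Nat.choose (2*N) (m+3) : ℤ) - 2 * Nat.choose N (m+3)
          - (N:ℤ) * Nat.choose N (m+2))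
      + 4 * ((Nat.choose (2*N) (m+4) : ℤ) - 2 * Nat.choose N (m+4)
          - 2*(N:ℤ) * Nat.choose N (m+3))
      - 4*(N:ℤ) * ((Nat.choose N (m+2) : ℤ) - ((N:ℤ) - 1) * Nat.choose N (m+1)) := by
  rcases le_or_gt 3 m with h | h
  · have hA := chA N (m+2) hN (by omega)
    have hB := chB N (m+2) (by omega)
    have hC : (0:ℤ) ≤ 4*(N:ℤ)*((N:ℤ)-1) * Nat.choose N (m+1) := by
      have : (0:ℤ) ≤ (N:ℤ)-1 := by omega
      positivity
    simp only [add_assoc] at *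
    norm_num at *
    linarith
  · obtain ⟨a1, a2, a3, a4, a5, a6⟩ := chsmall N
    obtain ⟨b1, b2, b3, b4, b5, b6⟩ := chsmall (2*N)
    obtain ⟨t, ht⟩ := Nat.exists_eq_add_of_le hN
    have ht' : (N:ℤ) = 2 + t := by exact_mod_cast ht
    push_cast at b1 b2 b3 b4 b5 b6
    suffices hs : ∀ X : ℤ, 0 ≤ 720 * X → 0 ≤ X by
      apply hs
      clear hs
      generalize (Nat.choose (2*N) 1 : ℤ) = y1 at *
      interval_cases m <;> norm_num only [Nat.reduceAdd]
      · have : (0:ℤ) ≤ 720 * ((N:ℤ)^2*(2*N-1)) := by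
          rw [ht']; ring_nf; positivity
        refine this.trans (le_of_eq ?_)
        rw [a1]
        linear_combination (-360*((N:ℤ)-2)^2) * b2 + (480*((N:ℤ)-2)) * b3 - 120 * b4 - (360*(2*(N:ℤ)^2-4*N-8)) * a2 + 120*16*a3 + 240 * a4
      · have : (0:ℤ) ≤ 720 * ((N:ℤ)^3*(N-1)) := by
          rw [ht']; ring_nf; positivity
        refine this.trans (le_of_eq ?_)
        linear_combination (-120*((N:ℤ)-2)^2) * b3 + (120*((N:ℤ)-2)) * b4 - 24 * b5 - (120*(2*(N:ℤ)^2-4*N-8)) * a3 + 30*16*a4 + 48 * a5 - 360*4*N*(N-1)*a2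
      · have e : 720 * ((N:ℤ) - 2)^2 * (Nat.choose (2*N) 4 : ℤ) - 720*4*((N:ℤ) - 2) * (Nat.choose (2*N) 5 : ℤ) + 720*4 * (Nat.choose (2*N) 6 : ℤ) + 720*(2*(N:ℤ)^2-4*N-8) * Nat.choose N 4 - 720*16 * Nat.choose N 5 - 720*8*Nat.choose N 6 + 720*4*N*(N-1)*Nat.choose N 3 = 
           30 * ((N:ℤ) - 2)^2 * (2*N*(2*N-1)*(2*N-2)*(2*N-3)) - 24*((N:ℤ) - 2) * (2*N*(2*N-1)*(2*N-2)*(2*N-3)*(2*N-4)) + 4 * (2*N*(2*N-1)*(2*N-2)*(2*N-3)*(2*N-4)*(2*N-5)) + 30*(2*(N:ℤ)^2-4*N-8) * (N*(N-1)*(N-2)*(N-3)) - 6*16 * (N*(N-1)*(N-2)*(N-3)*(N-4)) - 8*(N*(N-1)*(N-2)*(N-3)*(N-4)*(N-5)) + 120*4*N*(N-1)*(N*(N-1)*(N-2)) := by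
          rw [← a6, ← a5, ← a4, ← a3, ← b6, ← b5, ← b4]; ring
        have : (0:ℤ) ≤ 30 * ((N:ℤ) - 2)^2 * (2*N*(2*N-1)*(2*N-2)*(2*N-3)) - 24*((N:ℤ) - 2) * (2*N*(2*N-1)*(2*N-2)*(2*N-3)*(2*N-4)) + 4 * (2*N*(2*N-1)*(2*N-2)*(2*N-3)*(2*N-4)*(2*N-5)) + 30*(2*(N:ℤ)^2-4*N-8) * (N*(N-1)*(N-2)*(N-3)) - 6*16 * (N*(N-1)*(N-2)*(N-3)*(N-4)) - 8*(N*(N-1)*(N-2)*(N-3)*(N-4)*(N-5)) + 120*4*N*(N-1)*(N*(N-1)*(N-2)) := by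
          rw [ht']; ring_nf; positivity
        rw [← e] at this
        refine this.trans (le_of_eq ?_)
        ring
    intro X hX
    omega
end

section
/- As N → ∞ through the positive integers, N·( 3N² + 2γN + 4N·ψ(1/N) − 2N·ψ(2/N) ) converges to 4·ζ(3), where ζ(3) = Σ_{k=1}^∞ 1/k³. (The quantity 3N² + 2γN + 4Nψ(1/N) − 2Nψ(2/N) equals the expected squared norm of the sum of the N zeros of a random elliptic polynomial mapped to the sphere, computed from the exact formula for the expected Riesz (−2)-energy.) -/
open Filter

/-- The digamma function `ψ(x) = Γ'(x)/Γ(x)`. -/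
noncomputable def digamma (x : ℝ) : ℝ := deriv Real.Gamma x / Real.Gamma x

lemma dg_diff {x : ℝ} (hx : 0 < x) : DifferentiableAt ℝ Real.Gamma x :=
  Real.differentiableAt_Gamma (fun m => by
    have : (0:ℝ) ≤ m := Nat.cast_nonneg m
    intro h; linarith)

lemma dg_add_one {x : ℝ} (hx : 0 < x) : digamma (x + 1) = digamma x + 1 / x := by
  have h1 : deriv Real.Gamma (x + 1) = Real.Gamma x + x * deriv Real.Gamma x := by
    rw [← deriv_comp_add_const]
    have : (fun y : ℝ => Real.Gamma (y + 1)) =ᶠ[nhds x] fun y => y * Real.Gamma y := by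
      filter_upwards [lt_mem_nhds hx] with y hy
      exact Real.Gamma_add_one hy.ne'
    rw [this.deriv_eq]
    have h := ((hasDerivAt_id x).mul (dg_diff hx).hasDerivAt).deriv
    simp only [id, one_mul] at h
    exact h
  have hG := (Real.Gamma_pos_of_pos hx).ne'
  unfold digamma
  rw [h1, Real.Gamma_add_one hx.ne']
  have := hx.ne'
  field_simp
  ring

lemma dg_mono : MonotoneOn digamma (Set.Ioi 0) := by
  have hd : ∀ x ∈ Set.Ioi (0:ℝ), HasDerivAt (Real.log ∘ Real.Gamma) (digamma x) x := by
    intro x hx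
    exact (dg_diff hx).hasDerivAt.log (Real.Gamma_pos_of_pos hx).ne'
  have h := Real.convexOn_log_Gamma.monotoneOn_deriv
    (fun x hx => (hd x hx).differentiableAt)
  intro x hx y hy hxy
  have := h hx hy hxy
  rwa [(hd x hx).deriv, (hd y hy).deriv] at this

lemma dg_add_nat {x : ℝ} (hx : 0 ≤ x) (n : ℕ) :
    digamma (x + 1 + n) = digamma (x + 1) + ∑ k ∈ Finset.range n, 1 / ((k:ℝ) + 1 + x) := by
  induction n with
  | zero => simp
  | succ n ih =>
    rw [Finset.sum_range_succ, ← add_assoc, ← ih]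
    have : 0 < x + 1 + n := by positivity
    have h := dg_add_one this
    push_cast
    rw [← add_assoc, h]
    congr 2
    ring

lemma dg_one : digamma 1 = - Real.eulerMascheroniConstant := by
  unfold digamma
  rw [Real.eulerMascheroniConstant_eq_neg_deriv]
  simp

lemma dg_tendsto {x : ℝ} (hx : 0 ≤ x) (hx1 : x ≤ 1) :
    Tendsto (fun n : ℕ => ∑ k ∈ Finset.range n, (1 / ((k:ℝ) + 1) - 1 / ((k:ℝ) + 1 + x))) atTop
      (nhds (digamma (x + 1) + Real.eulerMascheroniConstant)) := by
  have key : ∀ n : ℕ, ∑ k ∈ Finset.range n, (1 / ((k:ℝ) + 1) - 1 / ((k:ℝ) + 1 + x))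
      = (digamma (x + 1) + Real.eulerMascheroniConstant)
        - (digamma (x + 1 + n) - digamma (1 + n)) := by
    intro n
    have h0 := dg_add_nat (le_refl (0:ℝ)) n
    have h1 := dg_add_nat hx n
    simp only [add_zero, zero_add, dg_one] at h0
    rw [Finset.sum_sub_distrib, h0, h1]
    ring
  have hl : Tendsto (fun n : ℕ => digamma (x + 1 + n) - digamma (1 + n)) atTop (nhds 0) := by
    refine squeeze_zero (g := fun n : ℕ => 1 / ((n:ℝ) + 1)) ?_ ?_
      tendsto_one_div_add_atTop_nhds_zero_nat
    · intro n
      have hn : (0:ℝ) ≤ n := Nat.cast_nonneg n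
      have := dg_mono (show (1 + n : ℝ) ∈ Set.Ioi (0:ℝ) by simp only [Set.mem_Ioi]; linarith)
        (show (x + 1 + n : ℝ) ∈ Set.Ioi (0:ℝ) by simp only [Set.mem_Ioi]; linarith) (by linarith)
      linarith
    · intro n
      have hn : (0:ℝ) ≤ n := Nat.cast_nonneg n
      have h2 := dg_mono (show (x + 1 + n : ℝ) ∈ Set.Ioi (0:ℝ) by
          simp only [Set.mem_Ioi]; linarith)
        (show ((1 + n) + 1 : ℝ) ∈ Set.Ioi (0:ℝ) by simp only [Set.mem_Ioi]; linarith)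
        (by linarith)
      have h3 := dg_add_one (show (0:ℝ) < 1 + n by linarith)
      rw [add_comm (n:ℝ) 1]
      linarith
  simp_rw [key]
  simpa using hl.const_sub (digamma (x + 1) + Real.eulerMascheroniConstant)

lemma dg_hasSum {x : ℝ} (hx : 0 < x) (hx1 : 2 * x ≤ 1) :
    HasSum (fun k : ℕ => 4 * (1 / (((k:ℝ) + 1) * (k + 1 + x) * (k + 1 + 2 * x))))
      ((2 * Real.eulerMascheroniConstant + 4 * digamma (x + 1) - 2 * digamma (2 * x + 1))
        / x ^ 2) := by
  rw [hasSum_iff_tendsto_nat_of_nonneg (fun k => by positivity)]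
  have h1 := dg_tendsto hx.le (by linarith)
  have h2 := dg_tendsto (x := 2 * x) (by linarith) hx1
  have h := ((h1.const_mul 4).sub (h2.const_mul 2)).div_const (x ^ 2)
  refine (h.congr ?_).trans_eq ?_
  · intro n
    rw [Finset.mul_sum, Finset.mul_sum, ← Finset.sum_sub_distrib, Finset.sum_div]
    refine Finset.sum_congr rfl fun k _ => ?_
    have a : (k:ℝ) + 1 ≠ 0 := by positivity
    have b : (k:ℝ) + 1 + x ≠ 0 := by positivity
    have c : (k:ℝ) + 1 + 2 * x ≠ 0 := by positivity
    field_simp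
    ring
  · congr 2
    ring

/-- As `N → ∞`, `N(3N² + 2γN + 4Nψ(1/N) − 2Nψ(2/N)) → 4ζ(3)`,
where `ζ(3) = Σ_{k≥1} 1/k³`. -/
theorem expected_squared_dipole_limit :
    Tendsto (fun N : ℕ =>
        (N:ℝ) * (3*(N:ℝ)^2 + 2*Real.eulerMascheroniConstant*(N:ℝ)
          + 4*(N:ℝ)*digamma (1/N) - 2*(N:ℝ)*digamma (2/N)))
      atTop (nhds (4 * ∑' k : ℕ, 1/((k:ℝ)+1)^3)) := by
  have hs : Summable (fun k : ℕ => 4 * (1 / ((k:ℝ) + 1) ^ 3)) := by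
    have h := (summable_nat_add_iff 1).2
      (Real.summable_one_div_nat_pow.2 (show 1 < 3 by norm_num))
    push_cast at h
    exact h.mul_left 4
  have hx : Tendsto (fun N : ℕ => 1 / (N:ℝ)) atTop (nhds 0) := tendsto_one_div_atTop_nhds_zero_nat
  have hlim : Tendsto (fun N : ℕ => ∑' k : ℕ,
      4 * (1 / (((k:ℝ) + 1) * (k + 1 + 1 / (N:ℝ)) * (k + 1 + 2 * (1 / (N:ℝ)))))) atTop
      (nhds (∑' k : ℕ, 4 * (1 / ((k:ℝ) + 1) ^ 3))) := by
    refine tendsto_tsum_of_dominated_convergence hs ?_ ?_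
    · intro k
      have a : (k:ℝ) + 1 ≠ 0 := by positivity
      have h := ((tendsto_const_nhds (x := (k:ℝ) + 1)).mul (hx.const_add ((k:ℝ) + 1))).mul
        ((hx.const_mul 2).const_add ((k:ℝ) + 1))
      have h' := (((tendsto_const_nhds (x := (1:ℝ))).div h (by simpa using a))).const_mul 4
      refine h'.trans_eq ?_
      congr 3
      ring
    · refine Eventually.of_forall fun N k => ?_
      have hN : (0:ℝ) ≤ 1 / N := by positivity
      rw [Real.norm_of_nonneg (by positivity), pow_three, ← mul_assoc]
      have h1 : (k:ℝ) + 1 ≤ k + 1 + 1 / (N:ℝ) := by linarith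
      have h2 : (k:ℝ) + 1 ≤ k + 1 + 2 * (1 / (N:ℝ)) := by linarith
      have h3 : ((k:ℝ) + 1) * (k + 1) * (k + 1)
          ≤ ((k:ℝ) + 1) * (k + 1 + 1 / (N:ℝ)) * (k + 1 + 2 * (1 / (N:ℝ))) :=
        mul_le_mul (mul_le_mul_of_nonneg_left h1 (by positivity)) h2 (by positivity)
          (by positivity)
      exact mul_le_mul_of_nonneg_left (one_div_le_one_div_of_le (by positivity) h3) (by norm_num)
  rw [tsum_mul_left] at hlim
  refine hlim.congr' ?_
  filter_upwards [eventually_ge_atTop 2] with N hN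
  have hN2 : (2:ℝ) ≤ N := by exact_mod_cast hN
  have hN0 : (0:ℝ) < N := by linarith
  have hx0 : (0:ℝ) < 1 / N := by positivity
  have hx1 : 2 * (1 / (N:ℝ)) ≤ 1 := by
    rw [mul_one_div, div_le_one hN0]; exact hN2
  rw [(dg_hasSum hx0 hx1).tsum_eq, dg_add_one hx0, dg_add_one (by linarith : 0 < 2 * (1 / (N:ℝ))),
    mul_one_div 2 (N:ℝ)]
  generalize digamma (1 / (N:ℝ)) = A
  generalize digamma (2 / (N:ℝ)) = B
  field_simp
  ring
end
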